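/- arXiv:2107.04516 — 2 statements merged into one kernel-verified Lean document; each statement's English description precedes it below -/
import Mathlib

section
/- Let u and v be vertices of the same stage in a balanced staged tree 𝒯, and suppose there is a root-to-leaf path λ_r passing through both u and the j-th child v_j of v, with u occurring before v on the path. Then there is a root-to-leaf path λ_s passing through the j-th child u_j of u such that φ_𝒯(p_r) = φ_𝒯(p_s), i.e. the homogenised products of edge labels along λ_r and λ_s are equal. -/
noncomputable section
open scoped Classical
open MvPolynomial

/-- A staged tree: a finite rooted tree with edges directed away from the root,
each non-root vertex `c` carrying the label `label c` of the edge from `parent c` to `c`;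
labels of outgoing edges of a vertex are pairwise distinct, and the outgoing label sets
of two vertices are either equal (same stage) or disjoint. -/
structure StagedTree (Θ : Type) [DecidableEq Θ] : Type 1 where
  V : Type
  fintypeV : Fintype V
  decEqV : DecidableEq V
  root : V
  parent : V → V
  label : V → Θ
  parent_root : parent root = root
  reaches_root : ∀ v : V, ∃ n : ℕ, parent^[n] v = root
  label_inj : ∀ u v : V, u ≠ root → v ≠ root → parent u = parent v → label u = label v → u = v
  stage_disjoint : ∀ u v : V,
    (∀ θ : Θ, (∃ c, c ≠ root ∧ parent c = u ∧ label c = θ) ↔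
        (∃ c, c ≠ root ∧ parent c = v ∧ label c = θ)) ∨
    (∀ θ : Θ, ¬((∃ c, c ≠ root ∧ parent c = u ∧ label c = θ) ∧
        (∃ c, c ≠ root ∧ parent c = v ∧ label c = θ)))

namespace StagedTree

attribute [instance] StagedTree.fintypeV StagedTree.decEqV

variable {Θ : Type} [DecidableEq Θ] (T : StagedTree Θ)

/-- `c` is a child of `v`. -/
def IsChild (v c : T.V) : Prop := c ≠ T.root ∧ T.parent c = v

/-- `v` is a leaf (no children). -/
def IsLeaf (v : T.V) : Prop := ∀ c, ¬ T.IsChild v c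

/-- `w` lies in the subtree rooted at `v` (i.e. `v` is an ancestor of `w` or `w` itself). -/
def Desc (v w : T.V) : Prop := ∃ n : ℕ, T.parent^[n] w = v

/-- Distance of `v` from the root. -/
def depthOf (v : T.V) : ℕ := Nat.find (T.reaches_root v)

/-- The depth `d` of the tree: maximal number of edges on a root-to-leaf path. -/
def depth : ℕ := Finset.univ.sup T.depthOf

/-- The type of leaves of `T`. -/
def Leaf : Type := {v : T.V // T.IsLeaf v}

instance : Fintype T.Leaf := Subtype.fintype _

/-- Product of the labels along the root-to-`v` path, in `ℝ[Θ]`. -/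
def pathProd (v : T.V) : MvPolynomial Θ ℝ :=
  ∏ i ∈ Finset.range (T.depthOf v), X (T.label (T.parent^[i] v))

/-- Homogenised root-to-`v` path monomial `z^(d - d(λ)) ∏ θ(e)` in `ℝ[Θ, z]`,
where the variable `none` plays the role of `z`. -/
def hpm (v : T.V) : MvPolynomial (Option Θ) ℝ :=
  (X none) ^ (T.depth - T.depthOf v) *
    ∏ i ∈ Finset.range (T.depthOf v), X (some (T.label (T.parent^[i] v)))

/-- The ideal `⟨θ - z⟩` of homogenised local sum-to-one conditions. -/
def sumIdeal : Ideal (MvPolynomial (Option Θ) ℝ) :=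
  Ideal.span {f | ∃ v : T.V, ¬ T.IsLeaf v ∧
    f = (∑ c ∈ Finset.univ.filter (fun c => T.IsChild v c), X (some (T.label c))) - X none}

/-- The homogenised parametrisation `φ_T : ℝ[p] → ℝ[Θ, z]/⟨θ - z⟩`. -/
def phi : MvPolynomial T.Leaf ℝ →ₐ[ℝ] MvPolynomial (Option Θ) ℝ ⧸ T.sumIdeal :=
  aeval (fun l : T.Leaf => Ideal.Quotient.mk T.sumIdeal (T.hpm l.1))

/-- The ideal `⟨θ - 1⟩` of local sum-to-one conditions. -/
def oneIdeal : Ideal (MvPolynomial Θ ℝ) :=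
  Ideal.span {f | ∃ v : T.V, ¬ T.IsLeaf v ∧
    f = (∑ c ∈ Finset.univ.filter (fun c => T.IsChild v c), X (T.label c)) - 1}

/-- The (non-homogenised) parametrisation `φ_T : ℝ[p] → ℝ[Θ]/⟨θ - 1⟩`. -/
def phi1 : MvPolynomial T.Leaf ℝ →ₐ[ℝ] MvPolynomial Θ ℝ ⧸ T.oneIdeal :=
  aeval (fun l : T.Leaf => Ideal.Quotient.mk T.oneIdeal (T.pathProd l.1))

/-- The subtree polynomial `t(v)`: sum over all `v`-to-leaf paths of the products of
edge labels along the path. -/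
def tpoly (v : T.V) : MvPolynomial Θ ℝ :=
  ∑ l ∈ Finset.univ.filter (fun w => T.IsLeaf w ∧ T.Desc v w),
    ∏ i ∈ Finset.range (T.depthOf l - T.depthOf v), X (T.label (T.parent^[i] l))

/-- Two non-leaf vertices are in the same stage when their outgoing label sets coincide. -/
def SameStage (u v : T.V) : Prop :=
  ¬ T.IsLeaf u ∧ ¬ T.IsLeaf v ∧
    ∀ θ : Θ, (∃ c, T.IsChild u c ∧ T.label c = θ) ↔ (∃ c, T.IsChild v c ∧ T.label c = θ)

/-- `T` is balanced: `t(u_i)·t(v_j) = t(u_j)·t(v_i)` for all `u ∼ v` and all pairs of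
children matched via the common labels. -/
def Balanced : Prop :=
  ∀ u v ui uj vi vj : T.V, T.SameStage u v →
    T.IsChild u ui → T.IsChild u uj → T.IsChild v vi → T.IsChild v vj →
    T.label ui = T.label vi → T.label uj = T.label vj →
    T.tpoly ui * T.tpoly vj = T.tpoly uj * T.tpoly vi

/-- `p_{[v]}`: sum of the variables `p_r` over root-to-leaf paths through `v`. -/
def pSum (v : T.V) : MvPolynomial T.Leaf ℝ :=
  ∑ l ∈ Finset.univ.filter (fun l : T.Leaf => T.Desc v l.1), X l

/-- `T` has toric structure: there are linearly independent linear forms in which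
`ker φ_T` is generated by binomials. -/
def Toric : Prop :=
  ∃ L : T.Leaf → MvPolynomial T.Leaf ℝ,
    (∀ i, (L i).IsHomogeneous 1) ∧ LinearIndependent ℝ L ∧
    ∃ B : Set (MvPolynomial T.Leaf ℝ),
      (∀ f ∈ B, ∃ a b : T.Leaf → ℕ, f = (∏ i, L i ^ a i) - (∏ i, L i ^ b i)) ∧
      RingHom.ker T.phi.toRingHom = Ideal.span B

end StagedTree

theorem Prime.dvd_or_exists_eq_mul_of_dvd_mul {R : Type*} [CommRing R] [IsDomain R] {f h p : R}
    (hp : Prime p) (hf : f ∣ h * p) : f ∣ h ∨ ∃ f', f' ∣ h ∧ f = f' * p := by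
  obtain ⟨g, hg⟩ := hf
  rcases hp.dvd_or_dvd (Dvd.intro_left h hg) with ⟨k, rfl⟩ | ⟨k, rfl⟩
  · refine Or.inr ⟨k, ⟨g, mul_right_cancel₀ hp.ne_zero ?_⟩, mul_comm _ _⟩
    linear_combination hg
  · refine Or.inl ⟨k, mul_right_cancel₀ hp.ne_zero ?_⟩
    linear_combination hg

namespace MvPolynomial

section Sign

variable {σ : Type*}

/-- All coefficients of `f` are nonnegative. -/
def CoeffNonneg (f : MvPolynomial σ ℝ) : Prop := ∀ m, 0 ≤ coeff m f

/-- All coefficients of `f` have the same sign. -/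
def CoeffSameSign (f : MvPolynomial σ ℝ) : Prop := CoeffNonneg f ∨ CoeffNonneg (-f)

theorem CoeffNonneg.sum {ι : Type*} {s : Finset ι} {f : ι → MvPolynomial σ ℝ}
    (hf : ∀ i ∈ s, CoeffNonneg (f i)) : CoeffNonneg (∑ i ∈ s, f i) := fun m => by
  rw [coeff_sum]; exact Finset.sum_nonneg fun i hi => hf i hi m

theorem CoeffNonneg.mul {f g : MvPolynomial σ ℝ} (hf : CoeffNonneg f) (hg : CoeffNonneg g) :
    CoeffNonneg (f * g) := fun m => by
  classical
  rw [coeff_mul]; exact Finset.sum_nonneg fun x _ => mul_nonneg (hf _) (hg _)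

theorem CoeffNonneg.eq_zero_of_neg {f : MvPolynomial σ ℝ} (hf : CoeffNonneg f)
    (hf' : CoeffNonneg (-f)) : f = 0 := by
  ext m
  have h := hf' m
  rw [coeff_neg] at h
  rw [coeff_zero]
  linarith [hf m]

theorem coeffNonneg_X (i : σ) : CoeffNonneg (X i : MvPolynomial σ ℝ) := fun m => by
  classical
  rw [coeff_X]; split_ifs <;> norm_num

theorem CoeffNonneg.add_mem_support_mul {f g : MvPolynomial σ ℝ} (hf : CoeffNonneg f)
    (hg : CoeffNonneg g) {m n : σ →₀ ℕ} (hm : m ∈ f.support) (hn : n ∈ g.support) :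
    m + n ∈ (f * g).support := by
  classical
  rw [mem_support_iff] at *
  rw [coeff_mul]
  refine (Finset.sum_pos' (fun x _ => mul_nonneg (hf _) (hg _))
    ⟨(m, n), Finset.HasAntidiagonal.mem_antidiagonal.2 rfl, ?_⟩).ne'
  exact mul_pos ((hf m).lt_of_ne' hm) ((hg n).lt_of_ne' hn)

theorem CoeffSameSign.neg {f : MvPolynomial σ ℝ} (hf : CoeffSameSign f) : CoeffSameSign (-f) := by
  rcases hf with h | h
  · exact Or.inr (by rwa [neg_neg])
  · exact Or.inl h

theorem CoeffSameSign.mul {f g : MvPolynomial σ ℝ} (hf : CoeffSameSign f)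
    (hg : CoeffSameSign g) : CoeffSameSign (f * g) := by
  rcases hf with hf | hf <;> rcases hg with hg | hg
  · exact Or.inl (hf.mul hg)
  · exact Or.inr (by simpa using hf.mul hg)
  · exact Or.inr (by simpa using hf.mul hg)
  · exact Or.inl (by simpa using hf.mul hg)

theorem CoeffSameSign.add_mem_support_mul {f g : MvPolynomial σ ℝ} (hf : CoeffSameSign f)
    (hg : CoeffSameSign g) {m n : σ →₀ ℕ} (hm : m ∈ f.support) (hn : n ∈ g.support) :
    m + n ∈ (f * g).support := by
  wlog hf' : CoeffNonneg f generalizing f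
  · have := this hf.neg (by rwa [support_neg]) (hf.resolve_left hf')
    rwa [neg_mul, support_neg] at this
  wlog hg' : CoeffNonneg g generalizing g
  · have := this hg.neg (by rwa [support_neg]) (hg.resolve_left hg')
    rwa [mul_neg, support_neg] at this
  exact hf'.add_mem_support_mul hg' hm hn

/-- If `h` and `f` have coefficients of constant sign and `h * f` has nonnegative coefficients,
then `f` has nonnegative coefficients as soon as `h` has. -/
theorem CoeffNonneg.of_mul {h f : MvPolynomial σ ℝ} (hh : CoeffNonneg h) (h0 : h ≠ 0)
    (hf : CoeffSameSign f) (hhf : CoeffNonneg (h * f)) : CoeffNonneg f := by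
  refine hf.elim id fun hf => ?_
  have hz := hhf.eq_zero_of_neg (by simpa using hh.mul hf)
  rw [(mul_eq_zero.1 hz).resolve_left h0]
  intro m
  simp

theorem CoeffSameSign.of_isUnit {f : MvPolynomial σ ℝ} (hf : IsUnit f) : CoeffSameSign f := by
  classical
  obtain ⟨r, -, rfl⟩ := isUnit_iff_eq_C_of_isReduced.1 hf
  rcases le_total 0 r with h | h
  · refine Or.inl fun m => ?_
    rw [coeff_C]; split_ifs <;> simp [h]
  · refine Or.inr fun m => ?_
    rw [coeff_neg, coeff_C]; split_ifs <;> simp [h]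

end Sign

section LinearForm

variable {σ : Type*}

theorem notMem_vars_of_dvd {f g : MvPolynomial σ ℝ} (hg : g ≠ 0) (hfg : f ∣ g) {i : σ}
    (hi : i ∉ g.vars) : i ∉ f.vars := by
  obtain ⟨k, rfl⟩ := hfg
  rw [mem_vars_iff_degreeOf_ne_zero, not_not] at *
  rw [degreeOf_mul_eq (left_ne_zero_of_mul hg) (right_ne_zero_of_mul hg)] at hi
  omega

/-- The form `∑ θ ∈ s, X θ * p θ`. -/
def linForm (s : Finset σ) (p : σ → MvPolynomial σ ℝ) : MvPolynomial σ ℝ := ∑ a ∈ s, X a * p a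

theorem linForm_congr {s : Finset σ} {p q : σ → MvPolynomial σ ℝ} (h : ∀ a ∈ s, p a = q a) :
    linForm s p = linForm s q :=
  Finset.sum_congr rfl fun a ha => by rw [h a ha]

theorem linForm_mul (s : Finset σ) (h : MvPolynomial σ ℝ) (p : σ → MvPolynomial σ ℝ) :
    linForm s (fun a => h * p a) = h * linForm s p := by
  simp only [linForm, Finset.mul_sum]
  exact Finset.sum_congr rfl fun a _ => by ring

/-- Cross-multiplied families with a primitive member are proportional. -/
theorem exists_eq_mul_of_cross_mul_eq {s : Finset σ} {p q : σ → MvPolynomial σ ℝ}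
    (hs : s.Nonempty) (hp0 : ∀ a ∈ s, p a ≠ 0)
    (hprim : ∀ d, (∀ a ∈ s, d ∣ p a) → IsUnit d)
    (h : ∀ a ∈ s, ∀ b ∈ s, q a * p b = q b * p a) : ∃ k, ∀ a ∈ s, q a = k * p a := by
  obtain ⟨_⟩ : Nonempty (NormalizedGCDMonoid (MvPolynomial σ ℝ)) := inferInstance
  have hdvd : ∀ a ∈ s, p a ∣ q a := by
    intro a ha
    have h1 : p a ∣ s.gcd fun b => q a * p b :=
      Finset.dvd_gcd fun b hb => ⟨q b, by rw [h a ha b hb, mul_comm]⟩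
    have h2 : IsUnit (s.gcd p) := hprim _ fun b hb => Finset.gcd_dvd hb
    exact (h1.trans (Finset.gcd_mul_left' s p (q a)).dvd).trans
      (by rw [IsUnit.mul_right_dvd h2])
  obtain ⟨i, hi⟩ := hs
  obtain ⟨k, hk⟩ := hdvd i hi
  refine ⟨k, fun a ha => mul_right_cancel₀ (hp0 i hi) ?_⟩
  rw [h a ha i hi, hk]
  ring

variable [DecidableEq σ]

/-- The substitution sending `X a` to `1` and the other variables of `s` to `0`. -/
def specializeVar (s : Finset σ) (a : σ) : MvPolynomial σ ℝ →ₐ[ℝ] MvPolynomial σ ℝ :=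
  aeval fun x => if x ∈ s then (if x = a then 1 else 0) else X x

theorem specializeVar_eq_self {s : Finset σ} (a : σ) {f : MvPolynomial σ ℝ}
    (hf : ∀ i ∈ s, i ∉ f.vars) : specializeVar s a f = f := by
  have h : (specializeVar s a : MvPolynomial σ ℝ →+* MvPolynomial σ ℝ) f =
      (RingHom.id (MvPolynomial σ ℝ)) f := by
    refine hom_congr_vars ?_ ?_ rfl
    · ext r; simp [specializeVar]
    · intro i hi _
      have : i ∉ s := fun h => hf i h hi
      simp [specializeVar, this]
  exact h

theorem specializeVar_linForm {s t : Finset σ} (hts : t ⊆ s) {a : σ} (ha : a ∈ t)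
    {p : σ → MvPolynomial σ ℝ} (hp : ∀ b ∈ t, ∀ i ∈ s, i ∉ (p b).vars) :
    specializeVar s a (linForm t p) = p a := by
  rw [linForm, map_sum, Finset.sum_eq_single a]
  · rw [map_mul, specializeVar_eq_self a (hp a ha)]
    simp [specializeVar, hts ha]
  · intro b hb hba
    rw [map_mul]
    simp [specializeVar, hts hb, hba]
  · exact fun h => absurd ha h

theorem prime_linForm {s : Finset σ} {p : σ → MvPolynomial σ ℝ} (hs : s.Nonempty)
    (hp0 : ∀ a ∈ s, p a ≠ 0) (hp : ∀ a ∈ s, ∀ i ∈ s, i ∉ (p a).vars)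
    (hprim : ∀ d, (∀ a ∈ s, d ∣ p a) → IsUnit d) : Prime (linForm s p) := by
  rw [← UniqueFactorizationMonoid.irreducible_iff_prime]
  obtain ⟨i, hi⟩ := hs
  have hsplit : linForm s p = p i * X i + linForm (s.erase i) p := by
    rw [linForm, ← Finset.add_sum_erase s _ hi, mul_comm (X i), linForm]
  rw [hsplit]
  refine irreducible_mul_X_add _ _ _ (hp0 i hi) (hp i hi i hi) ?_ ?_
  · intro hmem
    obtain ⟨b, hb, hib⟩ := Finset.mem_biUnion.1 (vars_sum_subset _ _ hmem)
    rcases Finset.mem_union.1 (vars_mul _ _ hib) with h | h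
    · rw [vars_X, Finset.mem_singleton] at h
      exact (Finset.mem_erase.1 hb).1 h.symm
    · exact hp b (Finset.mem_of_mem_erase hb) i hi h
  · rintro d hd ⟨e, he⟩
    refine hprim d fun a ha => ?_
    by_cases hai : a = i
    · rwa [hai]
    · have hdfree : ∀ j ∈ s, j ∉ d.vars := fun j hj =>
        notMem_vars_of_dvd (hp0 i hi) hd (hp i hi j hj)
      have := congrArg (specializeVar s a) he
      rw [specializeVar_linForm (Finset.erase_subset i s) (Finset.mem_erase.2 ⟨hai, ha⟩)
        (fun b hb => hp b (Finset.mem_of_mem_erase hb)), map_mul,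
        specializeVar_eq_self a hdfree] at this
      exact ⟨_, this⟩

theorem single_add_mem_support_linForm {s : Finset σ} {p : σ → MvPolynomial σ ℝ}
    (hp : ∀ a ∈ s, ∀ i ∈ s, i ∉ (p a).vars) {a : σ} (ha : a ∈ s) {m : σ →₀ ℕ}
    (hm : m ∈ (p a).support) : Finsupp.single a 1 + m ∈ (linForm s p).support := by
  rw [mem_support_iff, linForm, coeff_sum, Finset.sum_eq_single a]
  · rw [coeff_X_mul]
    exact mem_support_iff.1 hm
  · intro b hb hba
    by_contra hne
    obtain ⟨x, hx, y, hy, hxy⟩ := Finset.mem_add.1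
      (support_mul _ _ (mem_support_iff.2 hne))
    rw [support_X, Finset.mem_singleton] at hx
    subst hx
    have hay : y a = 0 := by
      by_contra h
      exact hp b hb a ha ((mem_vars_iff_mem_support a).2 ⟨y, hy, Finsupp.mem_support_iff.2 h⟩)
    have := DFunLike.congr_fun hxy a
    simp [hba, hay] at this
    omega
  · exact fun h => absurd ha h

/-- A prime linear form in the variables of `s` does not divide a polynomial which is free of
these variables. -/
theorem not_linForm_dvd {s : Finset σ} {p : σ → MvPolynomial σ ℝ} (hs : s.Nonempty)
    (hp0 : ∀ a ∈ s, p a ≠ 0) (hp : ∀ a ∈ s, ∀ i ∈ s, i ∉ (p a).vars)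
    {f : MvPolynomial σ ℝ} (hf0 : f ≠ 0) (hf : ∀ i ∈ s, i ∉ f.vars) : ¬ linForm s p ∣ f := by
  intro hdvd
  obtain ⟨a, ha⟩ := hs
  obtain ⟨m, hm⟩ := Finset.nonempty_iff_ne_empty.2 (mt support_eq_empty.1 (hp0 a ha))
  refine notMem_vars_of_dvd hf0 hdvd (hf a ha) ((mem_vars_iff_mem_support a).2
    ⟨_, single_add_mem_support_linForm hp ha hm, ?_⟩)
  simp

end LinearForm

end MvPolynomial

namespace StagedTree

variable {Θ : Type} [DecidableEq Θ] (T : StagedTree Θ)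

theorem depthOf_eq_zero {v : T.V} : T.depthOf v = 0 ↔ v = T.root := by
  simp [depthOf, Nat.find_eq_zero]

variable {T}

theorem IsChild.depthOf_eq {v c : T.V} (h : T.IsChild v c) : T.depthOf c = T.depthOf v + 1 := by
  obtain ⟨hc, rfl⟩ := h
  have h0 : ¬ T.parent^[0] c = T.root := hc
  exact Nat.find_comp_succ (T.reaches_root c) (T.reaches_root (T.parent c)) h0

theorem isChild_parent {v : T.V} (h : T.depthOf v ≠ 0) : T.IsChild (T.parent v) v :=
  ⟨mt T.depthOf_eq_zero.2 h, rfl⟩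

theorem depthOf_iterate (v : T.V) {n : ℕ} (hn : n ≤ T.depthOf v) :
    T.depthOf (T.parent^[n] v) + n = T.depthOf v := by
  induction n with
  | zero => rfl
  | succ n ih =>
    have h := ih (by omega)
    have hc := (isChild_parent (v := T.parent^[n] v) (by omega)).depthOf_eq
    rw [Function.iterate_succ_apply']
    omega

theorem iterate_depthOf (v : T.V) : T.parent^[T.depthOf v] v = T.root :=
  Nat.find_spec (T.reaches_root v)

theorem Desc.depthOf_le_and_iterate_eq {v w : T.V} (h : T.Desc v w) :
    T.depthOf v ≤ T.depthOf w ∧ T.parent^[T.depthOf w - T.depthOf v] w = v := by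
  obtain ⟨n, rfl⟩ := h
  rcases le_total n (T.depthOf w) with hn | hn
  · have := T.depthOf_iterate w hn
    exact ⟨by omega, by congr 1; omega⟩
  · have hroot : T.parent^[n] w = T.root := by
      obtain ⟨k, rfl⟩ := Nat.exists_eq_add_of_le' hn
      rw [Function.iterate_add_apply, T.iterate_depthOf, Function.iterate_fixed T.parent_root]
    rw [hroot, T.depthOf_eq_zero.2 rfl]
    exact ⟨Nat.zero_le _, T.iterate_depthOf w⟩

theorem Desc.depthOf_le {v w : T.V} (h : T.Desc v w) : T.depthOf v ≤ T.depthOf w :=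
  h.depthOf_le_and_iterate_eq.1

theorem Desc.iterate_eq {v w : T.V} (h : T.Desc v w) :
    T.parent^[T.depthOf w - T.depthOf v] w = v :=
  h.depthOf_le_and_iterate_eq.2

theorem Desc.refl (v : T.V) : T.Desc v v := ⟨0, rfl⟩

theorem IsChild.desc {v c w : T.V} (h : T.IsChild v c) (hw : T.Desc c w) : T.Desc v w := by
  obtain ⟨n, rfl⟩ := hw
  exact ⟨n + 1, by rw [Function.iterate_succ_apply', h.2]⟩

theorem Desc.exists_isChild {v w : T.V} (h : T.Desc v w) (hne : v ≠ w) :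
    ∃ c, T.IsChild v c ∧ T.Desc c w := by
  have hle := h.depthOf_le
  have hit := h.iterate_eq
  obtain ⟨k, hk⟩ : ∃ k, T.depthOf w - T.depthOf v = k + 1 := by
    refine Nat.exists_eq_succ_of_ne_zero fun h0 => hne ?_
    rw [h0] at hit
    exact hit.symm
  rw [hk, Function.iterate_succ_apply'] at hit
  have hd := T.depthOf_iterate w (n := k) (by omega)
  refine ⟨T.parent^[k] w, ⟨fun hr => ?_, hit⟩, k, rfl⟩
  rw [T.depthOf_eq_zero.2 hr] at hd
  omega

theorem IsChild.eq_of_desc {v c c' w : T.V} (h : T.IsChild v c) (h' : T.IsChild v c')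
    (hw : T.Desc c w) (hw' : T.Desc c' w) : c = c' := by
  rw [← hw.iterate_eq, ← hw'.iterate_eq, h.depthOf_eq, h'.depthOf_eq]

theorem depthOf_le_depth (v : T.V) : T.depthOf v ≤ T.depth :=
  Finset.le_sup (Finset.mem_univ v)

/-- Induction from the leaves towards the root. -/
theorem induction_from_leaves {motive : T.V → Prop}
    (step : ∀ v, (∀ c, T.IsChild v c → motive c) → motive v) (v : T.V) : motive v := by
  induction hn : T.depth - T.depthOf v using Nat.strong_induction_on generalizing v with
  | _ n ih =>
    refine step v fun c hc => ih (T.depth - T.depthOf c) ?_ c rfl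
    have := hc.depthOf_eq
    have := T.depthOf_le_depth c
    omega

variable (T)

/-- Exponent vector of the product of the labels along the path from `v` to `w`. -/
def pathExp (v w : T.V) : Θ →₀ ℕ :=
  ∑ i ∈ Finset.range (T.depthOf w - T.depthOf v), Finsupp.single (T.label (T.parent^[i] w)) 1

/-- Exponent vector of the product of the labels along the path from the root to `v`. -/
def rootExp (v : T.V) : Θ →₀ ℕ :=
  ∑ i ∈ Finset.range (T.depthOf v), Finsupp.single (T.label (T.parent^[i] v)) 1

variable {T}

theorem IsChild.rootExp_eq {v c : T.V} (h : T.IsChild v c) :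
    T.rootExp c = T.rootExp v + Finsupp.single (T.label c) 1 := by
  rw [rootExp, h.depthOf_eq, Finset.sum_range_succ', rootExp]
  obtain ⟨-, rfl⟩ := h
  rfl

theorem Desc.rootExp_eq {v w : T.V} (h : T.Desc v w) :
    T.rootExp w = T.rootExp v + T.pathExp v w := by
  have hle := h.depthOf_le
  have hsum : T.depthOf w = (T.depthOf w - T.depthOf v) + T.depthOf v := by omega
  rw [rootExp, hsum, Finset.sum_range_add, add_comm, rootExp, pathExp]
  congr 1
  refine Finset.sum_congr rfl fun i _ => ?_
  rw [add_comm, Function.iterate_add_apply, h.iterate_eq]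

theorem IsChild.pathExp_eq {v c w : T.V} (h : T.IsChild v c) (hw : T.Desc c w) :
    T.pathExp v w = Finsupp.single (T.label c) 1 + T.pathExp c w := by
  have h1 := (h.desc hw).rootExp_eq
  rw [hw.rootExp_eq, h.rootExp_eq, add_assoc] at h1
  exact (add_left_cancel h1).symm

theorem degree_rootExp (v : T.V) : (T.rootExp v).degree = T.depthOf v := by
  simp [rootExp]

theorem hpm_eq_of_rootExp_eq {v w : T.V} (h : T.rootExp v = T.rootExp w) : T.hpm v = T.hpm w := by
  have key : ∀ x : T.V, T.hpm x = X none ^ (T.depth - (T.rootExp x).degree) *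
      rename some (monomial (T.rootExp x) (1 : ℝ)) := fun x => by
    rw [degree_rootExp, rootExp, monomial_sum_one, map_prod, hpm]
    congr 1
    exact Finset.prod_congr rfl fun i _ => (rename_X _ _).symm
  rw [key, key, h]

theorem tpoly_eq_sum_monomial (v : T.V) :
    T.tpoly v = ∑ l ∈ Finset.univ.filter (fun w => T.IsLeaf w ∧ T.Desc v w),
      monomial (T.pathExp v l) (1 : ℝ) := by
  rw [tpoly]
  refine Finset.sum_congr rfl fun l _ => ?_
  rw [pathExp, monomial_sum_one]
  rfl

theorem coeffNonneg_tpoly (v : T.V) : CoeffNonneg (T.tpoly v) := by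
  rw [tpoly_eq_sum_monomial]
  refine CoeffNonneg.sum fun l _ m => ?_
  rw [coeff_monomial]
  split_ifs <;> norm_num

theorem mem_support_tpoly {v : T.V} {m : Θ →₀ ℕ} :
    m ∈ (T.tpoly v).support ↔ ∃ l, T.IsLeaf l ∧ T.Desc v l ∧ T.rootExp l = T.rootExp v + m := by
  constructor
  · intro hm
    rw [mem_support_iff, tpoly_eq_sum_monomial, coeff_sum] at hm
    obtain ⟨l, hl, hne⟩ := Finset.exists_ne_zero_of_sum_ne_zero hm
    obtain ⟨hleaf, hdesc⟩ := (Finset.mem_filter.1 hl).2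
    refine ⟨l, hleaf, hdesc, ?_⟩
    rw [coeff_monomial] at hne
    rw [hdesc.rootExp_eq, (ite_ne_right_iff.1 hne).1]
  · rintro ⟨l, hleaf, hdesc, hl⟩
    rw [hdesc.rootExp_eq] at hl
    rw [mem_support_iff, tpoly_eq_sum_monomial, coeff_sum]
    refine (Finset.sum_pos' (fun i _ => ?_)
      ⟨l, Finset.mem_filter.2 ⟨Finset.mem_univ l, hleaf, hdesc⟩, ?_⟩).ne'
    · rw [coeff_monomial]
      split_ifs <;> norm_num
    · rw [coeff_monomial, if_pos (add_left_cancel hl)]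
      norm_num

theorem IsLeaf.tpoly_eq {v : T.V} (h : T.IsLeaf v) : T.tpoly v = 1 := by
  have hset : Finset.univ.filter (fun w => T.IsLeaf w ∧ T.Desc v w) = {v} := by
    ext w
    simp only [Finset.mem_filter, Finset.mem_univ, true_and, Finset.mem_singleton]
    constructor
    · rintro ⟨-, hw⟩
      by_contra hne
      obtain ⟨c, hc, -⟩ := hw.exists_isChild (Ne.symm hne)
      exact h c hc
    · rintro rfl
      exact ⟨h, Desc.refl _⟩
  rw [tpoly, hset, Finset.sum_singleton, Nat.sub_self, Finset.range_zero, Finset.prod_empty]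

theorem tpoly_eq_sum_children {v : T.V} (h : ¬ T.IsLeaf v) :
    T.tpoly v = ∑ c ∈ Finset.univ.filter (fun c => T.IsChild v c), X (T.label c) * T.tpoly c := by
  have hset : Finset.univ.filter (fun w => T.IsLeaf w ∧ T.Desc v w) =
      (Finset.univ.filter (fun c => T.IsChild v c)).biUnion
        fun c => Finset.univ.filter (fun w => T.IsLeaf w ∧ T.Desc c w) := by
    ext w
    simp only [Finset.mem_filter, Finset.mem_univ, true_and, Finset.mem_biUnion]
    constructor
    · rintro ⟨hw, hvw⟩
      obtain ⟨c, hc, hcw⟩ := hvw.exists_isChild (by rintro rfl; exact h hw)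
      exact ⟨c, hc, hw, hcw⟩
    · rintro ⟨c, hc, hw, hcw⟩
      exact ⟨hw, hc.desc hcw⟩
  rw [tpoly_eq_sum_monomial, hset, Finset.sum_biUnion]
  · refine Finset.sum_congr rfl fun c hc => ?_
    rw [tpoly_eq_sum_monomial, Finset.mul_sum]
    refine Finset.sum_congr rfl fun l hl => ?_
    rw [(Finset.mem_filter.1 hc).2.pathExp_eq (Finset.mem_filter.1 hl).2.2, X, monomial_mul,
      one_mul]
  · intro c hc c' hc' hne
    refine Finset.disjoint_left.2 fun l hl hl' => hne ?_
    rw [Finset.mem_coe, Finset.mem_filter] at hc hc'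
    exact hc.2.eq_of_desc hc'.2 (Finset.mem_filter.1 hl).2.2 (Finset.mem_filter.1 hl').2.2

theorem exists_leaf_desc (v : T.V) : ∃ l, T.IsLeaf l ∧ T.Desc v l := by
  induction v using T.induction_from_leaves with
  | step v ih =>
    by_cases h : T.IsLeaf v
    · exact ⟨v, h, Desc.refl v⟩
    · rw [IsLeaf] at h
      push Not at h
      obtain ⟨c, hc⟩ := h
      obtain ⟨l, hl, hcl⟩ := ih c hc
      exact ⟨l, hl, hc.desc hcl⟩

theorem tpoly_ne_zero (v : T.V) : T.tpoly v ≠ 0 := by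
  obtain ⟨l, hl, hvl⟩ := T.exists_leaf_desc v
  intro h
  have := mem_support_tpoly.2 ⟨l, hl, hvl, hvl.rootExp_eq⟩
  rw [h] at this
  simp at this

variable (T)

/-- The labels of the outgoing edges of `v`. -/
def labels (v : T.V) : Finset Θ := (Finset.univ.filter (fun c => T.IsChild v c)).image T.label

/-- The polynomial `t(c)` of the child `c` of `v` along the edge labelled `a`. -/
def childPoly (v : T.V) (a : Θ) : MvPolynomial Θ ℝ :=
  if h : ∃ c, T.IsChild v c ∧ T.label c = a then T.tpoly h.choose else 0

variable {T}

theorem mem_labels {v : T.V} {a : Θ} : a ∈ T.labels v ↔ ∃ c, T.IsChild v c ∧ T.label c = a := by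
  simp [labels]

theorem IsChild.label_mem {v c : T.V} (h : T.IsChild v c) : T.label c ∈ T.labels v :=
  mem_labels.2 ⟨c, h, rfl⟩

theorem IsChild.eq_of_label_eq {v c c' : T.V} (h : T.IsChild v c) (h' : T.IsChild v c')
    (hl : T.label c = T.label c') : c = c' :=
  T.label_inj c c' h.1 h'.1 (h.2.trans h'.2.symm) hl

theorem IsChild.childPoly_label {v c : T.V} (h : T.IsChild v c) :
    T.childPoly v (T.label c) = T.tpoly c := by
  have hex : ∃ c', T.IsChild v c' ∧ T.label c' = T.label c := ⟨c, h, rfl⟩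
  rw [childPoly, dif_pos hex, hex.choose_spec.1.eq_of_label_eq h hex.choose_spec.2]

theorem labels_nonempty {v : T.V} (h : ¬ T.IsLeaf v) : (T.labels v).Nonempty := by
  rw [IsLeaf] at h
  push Not at h
  obtain ⟨c, hc⟩ := h
  exact ⟨_, hc.label_mem⟩

theorem tpoly_eq_linForm {v : T.V} (h : ¬ T.IsLeaf v) :
    T.tpoly v = linForm (T.labels v) (T.childPoly v) := by
  rw [tpoly_eq_sum_children h, linForm, labels, Finset.sum_image]
  · refine Finset.sum_congr rfl fun c hc => ?_
    rw [(Finset.mem_filter.1 hc).2.childPoly_label]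
  · intro c hc c' hc' hl
    rw [Finset.mem_coe, Finset.mem_filter] at hc hc'
    exact hc.2.eq_of_label_eq hc'.2 hl

theorem SameStage.refl {v : T.V} (h : ¬ T.IsLeaf v) : T.SameStage v v := ⟨h, h, fun _ => Iff.rfl⟩

theorem SameStage.symm {u v : T.V} (h : T.SameStage u v) : T.SameStage v u :=
  ⟨h.2.1, h.1, fun a => (h.2.2 a).symm⟩

theorem SameStage.trans {u v w : T.V} (h : T.SameStage u v) (h' : T.SameStage v w) :
    T.SameStage u w :=
  ⟨h.1, h'.2.1, fun a => (h.2.2 a).trans (h'.2.2 a)⟩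

theorem SameStage.labels_eq {u v : T.V} (h : T.SameStage u v) : T.labels u = T.labels v := by
  ext a
  rw [mem_labels, mem_labels, h.2.2]

theorem sameStage_of_mem_labels {u v : T.V} {a : Θ} (hu : a ∈ T.labels u) (hv : a ∈ T.labels v) :
    T.SameStage u v := by
  rw [mem_labels] at hu hv
  have huleaf : ¬ T.IsLeaf u := fun h => let ⟨c, hc, _⟩ := hu; h c hc
  have hvleaf : ¬ T.IsLeaf v := fun h => let ⟨c, hc, _⟩ := hv; h c hc
  refine ⟨huleaf, hvleaf, ?_⟩
  simp only [IsChild, and_assoc] at hu hv ⊢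
  exact (T.stage_disjoint u v).resolve_right fun h => h a ⟨hu, hv⟩

theorem exists_desc_of_mem_vars_tpoly (w : T.V) {a : Θ} (ha : a ∈ (T.tpoly w).vars) :
    ∃ w', T.Desc w w' ∧ a ∈ T.labels w' := by
  induction w using T.induction_from_leaves with
  | step w ih =>
    by_cases h : T.IsLeaf w
    · rw [h.tpoly_eq, vars_one] at ha
      simp at ha
    · rw [tpoly_eq_sum_children h] at ha
      obtain ⟨c, hc, hac⟩ := Finset.mem_biUnion.1 (vars_sum_subset _ _ ha)
      have hc := (Finset.mem_filter.1 hc).2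
      rcases Finset.mem_union.1 (vars_mul _ _ hac) with h1 | h1
      · rw [vars_X, Finset.mem_singleton] at h1
        exact ⟨w, Desc.refl w, h1 ▸ hc.label_mem⟩
      · obtain ⟨w', hw', haw'⟩ := ih c hc h1
        exact ⟨w', hc.desc hw', haw'⟩

/-- The family `p` is primitive, free of the labels of the stage of `v`, and for every vertex `u`
of this stage the subtree polynomials of the children of `u` are proportional to `p`. -/
structure IsStageForm (v : T.V) (p : Θ → MvPolynomial Θ ℝ) : Prop where
  ne_zero : ∀ a ∈ T.labels v, p a ≠ 0
  free : ∀ a ∈ T.labels v, ∀ i ∈ T.labels v, i ∉ (p a).vars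
  primitive : ∀ d, (∀ a ∈ T.labels v, d ∣ p a) → IsUnit d
  proportional : ∀ u, T.SameStage v u → ∃ h, ∀ a ∈ T.labels v, T.childPoly u a = h * p a

theorem Balanced.exists_isStageForm (hbal : T.Balanced) {v : T.V} (hv : ¬ T.IsLeaf v) :
    ∃ p, IsStageForm v p := by
  obtain ⟨w, hw, hmax⟩ := (Finset.univ.filter (fun w => T.SameStage v w)).exists_max_image
    T.depthOf ⟨v, Finset.mem_filter.2 ⟨Finset.mem_univ v, SameStage.refl hv⟩⟩
  have hw := (Finset.mem_filter.1 hw).2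
  have hs := T.labels_nonempty hv
  obtain ⟨_⟩ : Nonempty (NormalizedGCDMonoid (MvPolynomial Θ ℝ)) := inferInstance
  obtain ⟨p, hp, hgcd⟩ := Finset.extract_gcd (T.childPoly w) hs
  have hchild : ∀ a ∈ T.labels v, ∃ c, T.IsChild w c ∧ T.label c = a := fun a ha =>
    mem_labels.1 (hw.labels_eq ▸ ha)
  have hq0 : ∀ a ∈ T.labels v, T.childPoly w a ≠ 0 := by
    intro a ha
    obtain ⟨c, hc, rfl⟩ := hchild a ha
    rw [hc.childPoly_label]
    exact T.tpoly_ne_zero c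
  have hp0 : ∀ a ∈ T.labels v, p a ≠ 0 := fun a ha h => hq0 a ha (by rw [hp a ha, h, mul_zero])
  have hG0 : (T.labels v).gcd (T.childPoly w) ≠ 0 := fun h => by
    obtain ⟨a, ha⟩ := hs
    exact hq0 a ha (by rw [hp a ha, h, zero_mul])
  have hprim : ∀ d, (∀ a ∈ T.labels v, d ∣ p a) → IsUnit d := fun d hd =>
    isUnit_of_dvd_one (hgcd ▸ Finset.dvd_gcd hd)
  refine ⟨p, hp0, ?_, hprim, ?_⟩
  · intro a ha i hi
    refine notMem_vars_of_dvd (hq0 a ha) ⟨_, (hp a ha).trans (mul_comm _ _)⟩ fun hmem => ?_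
    obtain ⟨c, hc, rfl⟩ := hchild a ha
    rw [hc.childPoly_label] at hmem
    obtain ⟨w', hcw', hw'⟩ := T.exists_desc_of_mem_vars_tpoly c hmem
    have h1 := hmax w' (Finset.mem_filter.2 ⟨Finset.mem_univ _, sameStage_of_mem_labels hi hw'⟩)
    have h2 := hcw'.depthOf_le
    have h3 := hc.depthOf_eq
    omega
  · intro u hu
    refine exists_eq_mul_of_cross_mul_eq hs hp0 hprim fun a ha b hb => ?_
    obtain ⟨ca, hca, hla⟩ := mem_labels.1 (hu.labels_eq ▸ ha)
    obtain ⟨cb, hcb, hlb⟩ := mem_labels.1 (hu.labels_eq ▸ hb)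
    obtain ⟨da, hda, hma⟩ := hchild a ha
    obtain ⟨db, hdb, hmb⟩ := hchild b hb
    have hkey := hbal u w ca cb da db (hu.symm.trans hw) hca hcb hda hdb
      (hla.trans hma.symm) (hlb.trans hmb.symm)
    rw [← hca.childPoly_label, ← hcb.childPoly_label, ← hda.childPoly_label,
      ← hdb.childPoly_label, hla, hlb, hma, hmb, hp a ha, hp b hb] at hkey
    refine mul_left_cancel₀ hG0 ?_
    linear_combination hkey

namespace IsStageForm

variable {v : T.V} {p : Θ → MvPolynomial Θ ℝ}

theorem prime (hp : IsStageForm v p) (hv : ¬ T.IsLeaf v) : Prime (linForm (T.labels v) p) :=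
  prime_linForm (T.labels_nonempty hv) hp.ne_zero hp.free hp.primitive

theorem exists_factor (hp : IsStageForm v p) {u : T.V} (hu : T.SameStage v u) :
    ∃ h, T.tpoly u = h * linForm (T.labels v) p ∧
      ∀ c, T.IsChild u c → T.tpoly c = h * p (T.label c) := by
  obtain ⟨h, hh⟩ := hp.proportional u hu
  refine ⟨h, ?_, fun c hc => ?_⟩
  · rw [tpoly_eq_linForm hu.2.1, ← linForm_mul, hu.labels_eq]
    exact linForm_congr (hu.labels_eq ▸ hh)
  · rw [← hc.childPoly_label]
    exact hh _ (hu.labels_eq ▸ hc.label_mem)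

end IsStageForm

/-- In a balanced staged tree the divisors of the subtree polynomials have coefficients of
constant sign. -/
theorem Balanced.coeffSameSign_of_dvd_tpoly (hbal : T.Balanced) (v : T.V)
    {f : MvPolynomial Θ ℝ} (hf : f ∣ T.tpoly v) : CoeffSameSign f := by
  induction v using T.induction_from_leaves generalizing f with
  | step v ih =>
    by_cases hv : T.IsLeaf v
    · exact .of_isUnit (isUnit_of_dvd_one (hv.tpoly_eq ▸ hf))
    obtain ⟨p, hp⟩ := hbal.exists_isStageForm hv
    obtain ⟨h, htv, htc⟩ := hp.exists_factor (SameStage.refl hv)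
    obtain ⟨b, hb⟩ := T.labels_nonempty hv
    obtain ⟨d, hd, rfl⟩ := mem_labels.1 hb
    have hh : ∀ g, g ∣ h → CoeffSameSign g := fun g hg =>
      ih d hd (hg.trans ⟨_, htc d hd⟩)
    have h0 : h ≠ 0 := fun h0 => T.tpoly_ne_zero d (by rw [htc d hd, h0, zero_mul])
    have hpa : ∀ a ∈ T.labels v, CoeffSameSign (p a) ∧ CoeffNonneg (h * p a) := by
      intro a ha
      obtain ⟨c, hc, rfl⟩ := mem_labels.1 ha
      exact ⟨ih c hc ⟨h, (htc c hc).trans (mul_comm _ _)⟩, htc c hc ▸ T.coeffNonneg_tpoly c⟩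
    have hL : CoeffSameSign (linForm (T.labels v) p) := by
      rcases hh h dvd_rfl with hpos | hneg
      · exact Or.inl (CoeffNonneg.sum fun a ha =>
          (coeffNonneg_X a).mul (hpos.of_mul h0 (hpa a ha).1 (hpa a ha).2))
      · refine Or.inr ?_
        rw [linForm, ← Finset.sum_neg_distrib]
        refine CoeffNonneg.sum fun a ha => ?_
        rw [← mul_neg]
        exact (coeffNonneg_X a).mul (hneg.of_mul (neg_ne_zero.2 h0) (hpa a ha).1.neg
          (by rw [neg_mul_neg]; exact (hpa a ha).2))
    rw [htv] at hf
    rcases (hp.prime hv).dvd_or_exists_eq_mul_of_dvd_mul hf with hfh | ⟨f', hf', rfl⟩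
    · exact hh f hfh
    · exact (hh f' hf').mul hL

/-- Let `t(w) = h * P` with `P` free of the labels of the stage of a descendant `v` of `w`. A
monomial of the path from `w` to `v` times a monomial of the cofactor of the stage form in `t(v)`
splits into a monomial of `P` and a monomial which multiplies the stage form into `h`. -/
theorem Balanced.exists_split (hbal : T.Balanced) {v : T.V} (hv : ¬ T.IsLeaf v)
    {p : Θ → MvPolynomial Θ ℝ} (hp : IsStageForm v p) {g : MvPolynomial Θ ℝ}
    (hg : T.tpoly v = g * linForm (T.labels v) p) {m : Θ →₀ ℕ} (hm : m ∈ g.support)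
    {w : T.V} (hw : T.Desc w v) {h P : MvPolynomial Θ ℝ} (hP : T.tpoly w = h * P)
    (hfree : ∀ i ∈ T.labels v, i ∉ P.vars) :
    ∃ mh mp, mp ∈ P.support ∧ (∀ x ∈ (linForm (T.labels v) p).support, mh + x ∈ h.support) ∧
      T.rootExp w + (mh + mp) = T.rootExp v + m := by
  induction w using T.induction_from_leaves generalizing h P with
  | step w ih =>
    have hP0 : P ≠ 0 := fun h0 => T.tpoly_ne_zero w (by rw [hP, h0, mul_zero])
    have hsign : ∀ {f}, f ∣ T.tpoly w → CoeffSameSign f := hbal.coeffSameSign_of_dvd_tpoly w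
    by_cases hwv : w = v
    · subst hwv
      have hprime := hp.prime hv
      obtain ⟨k, rfl⟩ : linForm (T.labels w) p ∣ h :=
        (hprime.dvd_or_dvd (Dvd.intro_left g (hg.symm.trans hP))).resolve_right
          (not_linForm_dvd (T.labels_nonempty hv) hp.ne_zero hp.free hP0 hfree)
      have hgk : g = k * P := mul_right_cancel₀ hprime.ne_zero (by
        linear_combination hP - hg)
      rw [hgk] at hm
      obtain ⟨mh, hmh, mp, hmp, rfl⟩ := Finset.mem_add.1 (support_mul _ _ hm)
      refine ⟨mh, mp, hmp, fun x hx => ?_, rfl⟩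
      rw [mul_comm]
      exact (hsign ⟨linForm (T.labels w) p * P, by rw [hP]; ring⟩).add_mem_support_mul
        (hsign ⟨k * P, by rw [hP]; ring⟩) hmh hx
    · obtain ⟨c, hc, hcv⟩ := hw.exists_isChild hwv
      have hwl : ¬ T.IsLeaf w := fun hl => hl c hc
      obtain ⟨q, hq⟩ := hbal.exists_isStageForm hwl
      obtain ⟨k, htw, htc⟩ := hq.exists_factor (SameStage.refl hwl)
      have htc := htc c hc
      have hprime := hq.prime hwl
      have hLw : linForm (T.labels w) q ∣ T.tpoly w := ⟨k, by rw [htw, mul_comm]⟩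
      have hlift : ∀ {f y}, f ∣ T.tpoly w → y ∈ (f * q (T.label c)).support →
          Finsupp.single (T.label c) 1 + y ∈ (f * linForm (T.labels w) q).support := by
        intro f y hf hy
        obtain ⟨y₁, hy₁, y₂, hy₂, rfl⟩ := Finset.mem_add.1 (support_mul _ _ hy)
        rw [add_left_comm]
        exact (hsign hf).add_mem_support_mul (hsign hLw) hy₁
          (single_add_mem_support_linForm hq.free hc.label_mem hy₂)
      rcases hprime.dvd_or_dvd (Dvd.intro_left k (htw.symm.trans hP)) with ⟨h', rfl⟩ | ⟨P', rfl⟩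
      · have hk : k = h' * P := mul_right_cancel₀ hprime.ne_zero (by
          linear_combination hP - htw)
        obtain ⟨mh, mp, hmp, hmh, hsum⟩ := ih c hc hcv (h := h' * q (T.label c)) (P := P)
          (by rw [htc, hk]; ring) hfree
        refine ⟨Finsupp.single (T.label c) 1 + mh, mp, hmp, fun x hx => ?_, ?_⟩
        · rw [add_assoc, mul_comm]
          exact hlift ⟨linForm (T.labels w) q * P, by rw [hP]; ring⟩ (hmh x hx)
        · rw [← hsum, hc.rootExp_eq]
          abel
      · have hk : k = h * P' := mul_right_cancel₀ hprime.ne_zero (by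
          linear_combination hP - htw)
        have hP'dvd : P' ∣ T.tpoly w := ⟨h * linForm (T.labels w) q, by rw [hP]; ring⟩
        have hmem : ∀ {y}, y ∈ (P' * q (T.label c)).support →
            Finsupp.single (T.label c) 1 + y ∈ (linForm (T.labels w) q * P').support := by
          intro y hy
          rw [mul_comm (linForm _ _)]
          exact hlift hP'dvd hy
        obtain ⟨mh, mp, hmp, hmh, hsum⟩ := ih c hc hcv (h := h) (P := P' * q (T.label c))
          (by rw [htc, hk]; ring) (by
            intro i hi hmi
            obtain ⟨y, hy, hiy⟩ := (mem_vars_iff_mem_support i).1 hmi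
            refine hfree i hi ((mem_vars_iff_mem_support i).2 ⟨_, hmem hy, ?_⟩)
            rw [Finsupp.mem_support_iff] at hiy ⊢
            rw [Finsupp.add_apply]
            omega)
        refine ⟨mh, Finsupp.single (T.label c) 1 + mp, hmem hmp, hmh, ?_⟩
        rw [← hsum, hc.rootExp_eq]
        abel

end StagedTree

namespace StagedTree

variable {Θ : Type} [DecidableEq Θ] (T : StagedTree Θ)

/-- Let `u ∼ v` be vertices of the same stage in a balanced staged tree
and let `λ_r` be a root-to-leaf path passing through `u` and through the `j`-th child `v_j`
of `v`, with `u` occurring strictly before `v`. Then there is a root-to-leaf path `λ_s`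
through the matching child `u_j` of `u` with `φ_𝒯(p_r) = φ_𝒯(p_s)`. -/
theorem exists_path_same_image (hbal : T.Balanced)
    (u v vj lr : T.V) (huv : T.SameStage u v)
    (huva : T.Desc u v) (hne : u ≠ v)
    (hvj : T.IsChild v vj) (hlr : T.IsLeaf lr) (hthrough : T.Desc vj lr) :
    ∃ uj ls : T.V, T.IsChild u uj ∧ T.label uj = T.label vj ∧
      T.IsLeaf ls ∧ T.Desc uj ls ∧
      Ideal.Quotient.mk T.sumIdeal (T.hpm lr) = Ideal.Quotient.mk T.sumIdeal (T.hpm ls) := by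
  obtain ⟨p, hp⟩ := hbal.exists_isStageForm huv.2.1
  obtain ⟨g, htv, htvc⟩ := hp.exists_factor (SameStage.refl huv.2.1)
  obtain ⟨h, htu, htuc⟩ := hp.exists_factor huv.symm
  obtain ⟨ui, hui, huiv⟩ := huva.exists_isChild hne
  obtain ⟨uj, huj, hlab⟩ := (huv.2.2 (T.label vj)).2 ⟨vj, hvj, rfl⟩
  have hui_mem : T.label ui ∈ T.labels v := huv.labels_eq ▸ hui.label_mem
  have hc := mem_support_tpoly.2 ⟨lr, hlr, hthrough, hthrough.rootExp_eq⟩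
  rw [htvc vj hvj] at hc
  obtain ⟨m, hm, mj, hmj, hmc⟩ := Finset.mem_add.1 (support_mul _ _ hc)
  obtain ⟨mh, mp, hmp, hmh, hsum⟩ := hbal.exists_split huv.2.1 hp htv hm huiv (htuc ui hui)
    (hp.free _ hui_mem)
  have hx := hmh _ (single_add_mem_support_linForm hp.free hui_mem hmp)
  have htuj : T.tpoly uj = h * p (T.label vj) := hlab ▸ htuc uj huj
  have hmem := (hbal.coeffSameSign_of_dvd_tpoly uj ⟨_, htuj⟩).add_mem_support_mul
    (hbal.coeffSameSign_of_dvd_tpoly uj ⟨h, htuj.trans (mul_comm _ _)⟩) hx hmj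
  rw [← htuj] at hmem
  obtain ⟨ls, hls, hujls, hexp⟩ := mem_support_tpoly.1 hmem
  refine ⟨uj, ls, huj, hlab, hls, hujls, ?_⟩
  rw [hpm_eq_of_rootExp_eq (v := lr) (w := ls)]
  rw [hexp, hthrough.rootExp_eq, ← hmc, huj.rootExp_eq, hvj.rootExp_eq, hlab]
  rw [hui.rootExp_eq] at hsum
  calc T.rootExp v + Finsupp.single (T.label vj) 1 + (m + mj)
      = (T.rootExp v + m) + Finsupp.single (T.label vj) 1 + mj := by abel
    _ = _ := by rw [← hsum]; abel

end StagedTree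
end
end

section
/- Let 𝒯 be an SIP-tree with stratified version 𝒯_str, and let θ₁,…,θ_k be the labels of a stage of 𝒯_str. Let v be a vertex of 𝒯_str such that the root-to-v path passes through an edge labelled θ₁. Then for each i = 1,…,k there is a vertex u of 𝒯_str such that (θ_i/θ₁)·φ_{𝒯_str}(p_{[v]}) = φ_{𝒯_str}(p_{[u]}), i.e. the homogenised root-to-u path monomial is obtained from the root-to-v one by replacing one factor θ₁ by θ_i. Moreover, if v is not a leaf then u and v are in the same stage in 𝒯_str. -/
noncomputable section
open scoped Classical
open MvPolynomial

namespace StagedTree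

variable {Θ : Type} [DecidableEq Θ] (T : StagedTree Θ)

open MvPolynomial

/-- The induced subtree of `T` rooted at `v₁` is contained, as an edge-labelled coloured
tree, in the induced subtree rooted at `vi`, via an embedding sending `v₁` to `vi` which
preserves parents, edge labels and stages. -/
def SIPat (v1 vi : T.V) : Prop :=
  ∃ f : T.V → T.V, f v1 = vi ∧ Set.InjOn f {w | T.Desc v1 w} ∧
    (∀ w, T.Desc v1 w → w ≠ v1 →
      f w ≠ T.root ∧ T.parent (f w) = f (T.parent w) ∧ T.label (f w) = T.label w) ∧
    (∀ w, T.Desc v1 w → ¬ T.IsLeaf w → T.SameStage w (f w))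

/-- `T` is an SIP-tree (drawn so that `i_c = 1`, the first label being the least one):
for every vertex of every stage, the subtree rooted at the first child is contained in the
subtree rooted at each child. -/
def IsSIP [LinearOrder Θ] : Prop :=
  ∀ v c1 c : T.V, T.IsChild v c1 → T.IsChild v c →
    (∀ c', T.IsChild v c' → T.label c1 ≤ T.label c') → T.SIPat c1 c

/-- `x` is reached by a first-edge: the edge into `x` carries the first (least) label of
the stage of its parent. -/
def FirstEdge [LinearOrder Θ] (x : T.V) : Prop :=
  x ≠ T.root ∧ ∀ c, T.IsChild (T.parent x) c → T.label x ≤ T.label c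

end StagedTree

namespace StagedTree

variable {Θ : Type} [DecidableEq Θ] (T : StagedTree Θ)

open MvPolynomial

/-- The label, in the stratified tree `𝒯_str`, of the edge into the vertex `x`: the label
in `𝒯` tagged with the distance of the parent of `x` from the root (so that two vertices
of `𝒯_str` are in the same stage exactly when they are in the same stage of `𝒯` and lie
at the same distance from the root). -/
def labelStr (x : T.V) : Θ × ℕ :=
  (T.label x, T.depthOf (T.parent x))

/-- The homogenised root-to-`v` path monomial of the stratified tree `𝒯_str`, in
`ℝ[Θ_str, z]`; it represents `φ_{𝒯_str}(p_{[v]})`. -/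
def mStr (v : T.V) : MvPolynomial (Option (Θ × ℕ)) ℝ :=
  (X none) ^ (T.depth - T.depthOf v) *
    ∏ i ∈ Finset.range (T.depthOf v), X (some (T.labelStr (T.parent^[i] v)))

theorem depthOf_eq_parent_add_one {v : T.V} (hv : v ≠ T.root) :
    T.depthOf v = T.depthOf (T.parent v) + 1 := by
  unfold depthOf
  exact Nat.find_comp_succ (T.reaches_root v) (T.reaches_root (T.parent v)) hv

theorem parent_iterate_root (n : ℕ) : T.parent^[n] T.root = T.root :=
  Function.iterate_fixed T.parent_root n

/-- The root-to-`v` path product of the stratified labels, without homogenisation. -/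
def strPathProd (v : T.V) : MvPolynomial (Option (Θ × ℕ)) ℝ :=
  ∏ i ∈ Finset.range (T.depthOf v), X (some (T.labelStr (T.parent^[i] v)))

theorem strPathProd_eq_mul_parent {v : T.V} (hv : v ≠ T.root) :
    T.strPathProd v = X (some (T.labelStr v)) * T.strPathProd (T.parent v) := by
  rw [strPathProd, T.depthOf_eq_parent_add_one hv, Finset.prod_range_succ', mul_comm]
  rfl

theorem depthOf_eq_and_strPathProd_of_map {w0 c1 ci : T.V} {f : T.V → T.V}
    (hc1 : T.IsChild w0 c1) (hci : T.IsChild w0 ci) (hf : f c1 = ci)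
    (hstep : ∀ w, T.Desc c1 w → w ≠ c1 →
      f w ≠ T.root ∧ T.parent (f w) = f (T.parent w) ∧ T.label (f w) = T.label w)
    (n : ℕ) (w : T.V) (hw : T.parent^[n] w = c1) :
    T.depthOf w = T.depthOf (f w) ∧
      X (some (T.labelStr ci)) * T.strPathProd w =
        X (some (T.labelStr c1)) * T.strPathProd (f w) := by
  have base : T.depthOf c1 = T.depthOf (f c1) ∧
      X (some (T.labelStr ci)) * T.strPathProd c1 =
        X (some (T.labelStr c1)) * T.strPathProd (f c1) := by
    rw [hf, T.depthOf_eq_parent_add_one hc1.1, T.depthOf_eq_parent_add_one hci.1,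
      T.strPathProd_eq_mul_parent hc1.1, T.strPathProd_eq_mul_parent hci.1, hc1.2, hci.2]
    exact ⟨rfl, by ring⟩
  induction n generalizing w with
  | zero => obtain rfl : w = c1 := hw; exact base
  | succ n ih =>
    by_cases hwc : w = c1
    · rw [hwc]; exact base
    have hwr : w ≠ T.root := by
      rintro rfl
      exact hc1.1 (hw.symm.trans (T.parent_iterate_root _))
    obtain ⟨hfr, hfp, hfl⟩ := hstep w ⟨n + 1, hw⟩ hwc
    obtain ⟨hd, hp⟩ := ih (T.parent w) hw
    have hlab : T.labelStr (f w) = T.labelStr w := by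
      rw [labelStr, labelStr, hfl, hfp, hd]
    rw [T.depthOf_eq_parent_add_one hwr, T.depthOf_eq_parent_add_one hfr,
      T.strPathProd_eq_mul_parent hwr, T.strPathProd_eq_mul_parent hfr, hfp, hlab]
    exact ⟨by rw [hd], by rw [mul_left_comm, hp, mul_left_comm]⟩

/-- Let `𝒯` be an SIP-tree with stratified version `𝒯_str`, let
`θ₁,…,θ_k` be the labels of a stage of `𝒯_str` (the outgoing labels of a vertex `w₀`,
with `θ₁` the first one, carried by the child `c₁`), and let `v` be a vertex whose
root-to-`v` path passes through the edge labelled `θ₁`. Then for each `i = 1,…,k` there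
is a vertex `u` with `(θ_i/θ₁)·φ_{𝒯_str}(p_{[v]}) = φ_{𝒯_str}(p_{[u]})` (as path
monomials: `θ_i · m_v = θ₁ · m_u`); moreover if `v` is not a leaf then `u` and `v` are in
the same stage of `𝒯_str`. -/
theorem sip_str_exists_sibling_vertex [LinearOrder Θ] (hsip : T.IsSIP)
    (w0 c1 v : T.V) (hc1 : T.IsChild w0 c1)
    (hfirst : ∀ c', T.IsChild w0 c' → T.label c1 ≤ T.label c')
    (hv : T.Desc c1 v) :
    ∀ ci, T.IsChild w0 ci →
      ∃ u : T.V,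
        X (some (T.labelStr ci)) * T.mStr v = X (some (T.labelStr c1)) * T.mStr u ∧
        (¬ T.IsLeaf v → T.SameStage v u ∧ T.depthOf v = T.depthOf u) := by
  intro ci hci
  obtain ⟨f, hf, -, hstep, hstage⟩ := hsip w0 c1 ci hc1 hci hfirst
  obtain ⟨n, hn⟩ := hv
  obtain ⟨hd, hp⟩ := T.depthOf_eq_and_strPathProd_of_map hc1 hci hf hstep n v hn
  refine ⟨f v, ?_, fun hleaf => ⟨hstage v ⟨n, hn⟩ hleaf, hd⟩⟩
  change _ * (_ * T.strPathProd v) = _ * (_ * T.strPathProd (f v))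
  rw [mul_left_comm, hp, mul_left_comm, hd]

end StagedTree
end
end
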